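/- Set λ₃ = (2.365)². If q·α·Re < p·max( λ₃·π + 2^{3/2}·α³ , λ₃·π + π·α² ), then there is no solution v of the modified Orr–Sommerfeld equation, not identically zero on [-1,1], whose wave speed c satisfies Im(c) > 0; i.e. no amplified disturbances exist. -/

import Mathlib

open Real

open intervalIntegral in
theorem integral_le_zero_of_le_deriv {F F' φ : ℝ → ℝ}
    (hF : ∀ x ∈ Set.Icc (-1 : ℝ) 1, HasDerivAt F (F' x) x) (hφ : Continuous φ)
    (hle : ∀ x ∈ Set.Icc (-1 : ℝ) 1, φ x ≤ F' x) (h1 : F 1 = 0) (h2 : F (-1) = 0) :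
    ∫ x in (-1 : ℝ)..1, φ x ≤ 0 := by
  have h := integral_le_sub_of_hasDeriv_right_of_le (a := -1) (b := 1) (g := F) (g' := F') (φ := φ)
    (by norm_num) (fun x hx => (hF x hx).continuousAt.continuousWithinAt)
    (fun x hx => (hF x (Set.Ioo_subset_Icc_self hx)).hasDerivWithinAt)
    hφ.continuousOn.integrableOn_Icc
    (fun x hx => hle x (Set.Ioo_subset_Icc_self hx))
  simpa [h1, h2] using h

/-- Jacobi's form of the second variation: a positive solution `w₀` of the Wronskian equation
yields a lower bound for the bending energy of a clamped function. -/
theorem clamped_energy_le_of_wronskian {f f₁ f₂ w₀ w₁ w₂ w₃ w₄ : ℝ → ℝ} {κ k : ℝ}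
    (hf : ∀ x, HasDerivAt f (f₁ x) x) (hf₁ : ∀ x, HasDerivAt f₁ (f₂ x) x) (hf₂ : Continuous f₂)
    (fl : f (-1) = 0) (fr : f 1 = 0) (fl₁ : f₁ (-1) = 0) (fr₁ : f₁ 1 = 0)
    (hw₀ : ∀ x, HasDerivAt w₀ (w₁ x) x) (hw₁ : ∀ x, HasDerivAt w₁ (w₂ x) x)
    (hw₂ : ∀ x, HasDerivAt w₂ (w₃ x) x) (hw₃ : ∀ x, HasDerivAt w₃ (w₄ x) x)
    (hpos : ∀ x ∈ Set.Icc (-1 : ℝ) 1, 0 < w₀ x)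
    (hw : ∀ x, (w₂ x + κ * w₀ x) ^ 2 + 2 * w₀ x * (w₄ x + κ * w₂ x)
      - 2 * (w₃ x + κ * w₁ x) * w₁ x + 4 * k * w₀ x ^ 2 = 0) :
    κ * (∫ x in (-1 : ℝ)..1, f₁ x ^ 2) + k * (∫ x in (-1 : ℝ)..1, f x ^ 2)
      ≤ ∫ x in (-1 : ℝ)..1, f₂ x ^ 2 := by
  have cf : Continuous f := continuous_iff_continuousAt.2 fun x => (hf x).continuousAt
  have cf₁ : Continuous f₁ := continuous_iff_continuousAt.2 fun x => (hf₁ x).continuousAt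
  have key := integral_le_zero_of_le_deriv
    (F := fun x => -(w₁ x / w₀ x) * f₁ x ^ 2 + (w₂ x / w₀ x + κ) * (f x * f₁ x)
      - (w₃ x + κ * w₁ x) / (2 * w₀ x) * f x ^ 2)
    (F' := fun x => (f₂ x - w₁ x / w₀ x * f₁ x + (w₂ x / w₀ x + κ) / 2 * f x) ^ 2
      + (κ * f₁ x ^ 2 + k * f x ^ 2 - f₂ x ^ 2))
    (φ := fun x => κ * f₁ x ^ 2 + k * f x ^ 2 - f₂ x ^ 2) ?_ (by fun_prop) ?_
    (by simp [fr, fr₁]) (by simp [fl, fl₁])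
  · rw [intervalIntegral.integral_sub, intervalIntegral.integral_add,
      intervalIntegral.integral_const_mul, intervalIntegral.integral_const_mul] at key
    · linarith
    all_goals exact Continuous.intervalIntegrable (by fun_prop) _ _
  · intro x hx
    have h0 : w₀ x ≠ 0 := (hpos x hx).ne'
    have h20 : 2 * w₀ x ≠ 0 := by positivity
    have hk : k = -((w₂ x + κ * w₀ x) ^ 2 + 2 * w₀ x * (w₄ x + κ * w₂ x)
      - 2 * (w₃ x + κ * w₁ x) * w₁ x) / (4 * w₀ x ^ 2) := by
      field_simp
      linarith [hw x]
    have := (((((hw₁ x).div (hw₀ x) h0).neg).mul ((hf₁ x).pow 2)).add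
      ((((hw₂ x).div (hw₀ x) h0).add_const κ).mul ((hf x).mul (hf₁ x)))).sub
      ((((hw₃ x).add ((hw₁ x).const_mul κ)).div ((hw₀ x).const_mul 2) h20).mul ((hf x).pow 2))
    refine this.congr_deriv ?_
    simp only [Pi.add_apply, Pi.mul_apply, Pi.div_apply, Pi.neg_apply, Pi.pow_apply, hk]
    field_simp
    ring
  · intro x hx
    exact le_add_of_nonneg_left (sq_nonneg _)

theorem sq_mul_le_of_forall_lt {K X Y : ℝ} (hK : 0 < K)
    (h : ∀ k, 0 < k → k < K → k ^ 2 * Y ≤ X) : K ^ 2 * Y ≤ X := by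
  have ht : Filter.Tendsto (fun k : ℝ => k ^ 2 * Y) (nhdsWithin K (Set.Iio K)) (nhds (K ^ 2 * Y)) :=
    (Continuous.tendsto (by fun_prop) K).mono_left nhdsWithin_le_nhds
  refine le_of_tendsto ht ?_
  filter_upwards [Ioo_mem_nhdsLT hK] with k hk using h k hk.1 hk.2

theorem dirichlet_poincare {f f₁ : ℝ → ℝ}
    (hf : ∀ x, HasDerivAt f (f₁ x) x) (hf₁ : Continuous f₁)
    (fl : f (-1) = 0) (fr : f 1 = 0) :
    (π / 2) ^ 2 * (∫ x in (-1 : ℝ)..1, f x ^ 2) ≤ ∫ x in (-1 : ℝ)..1, f₁ x ^ 2 := by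
  have cf : Continuous f := continuous_iff_continuousAt.2 fun x => (hf x).continuousAt
  refine sq_mul_le_of_forall_lt (by positivity) fun k k0 kπ => ?_
  have key := integral_le_zero_of_le_deriv
    (F := fun x => k * (sin (k * x) / cos (k * x)) * f x ^ 2)
    (F' := fun x => (f₁ x + k * (sin (k * x) / cos (k * x)) * f x) ^ 2
      + (k ^ 2 * f x ^ 2 - f₁ x ^ 2))
    (φ := fun x => k ^ 2 * f x ^ 2 - f₁ x ^ 2) ?_ (by fun_prop) ?_ (by simp [fr]) (by simp [fl])
  · rw [intervalIntegral.integral_sub, intervalIntegral.integral_const_mul] at key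
    · linarith
    all_goals exact Continuous.intervalIntegrable (by fun_prop) _ _
  · intro x hx
    have h0 : cos (k * x) ≠ 0 :=
      (cos_pos_of_mem_Ioo ⟨by nlinarith [hx.1, hx.2], by nlinarith [hx.1, hx.2]⟩).ne'
    have hl : HasDerivAt (fun y : ℝ => k * y) k x := by
      simpa using (hasDerivAt_id x).const_mul k
    refine ((((hl.sin).div hl.cos h0).const_mul k).mul ((hf x).pow 2)).congr_deriv ?_
    simp only [Pi.div_apply, Pi.pow_apply]
    field_simp
    ring
  · intro x hx
    exact le_add_of_nonneg_left (sq_nonneg _)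

theorem clamped_poincare_deriv {f f₁ f₂ : ℝ → ℝ}
    (hf : ∀ x, HasDerivAt f (f₁ x) x) (hf₁ : ∀ x, HasDerivAt f₁ (f₂ x) x) (hf₂ : Continuous f₂)
    (fl : f (-1) = 0) (fr : f 1 = 0) (fl₁ : f₁ (-1) = 0) (fr₁ : f₁ 1 = 0) :
    π ^ 2 * (∫ x in (-1 : ℝ)..1, f₁ x ^ 2) ≤ ∫ x in (-1 : ℝ)..1, f₂ x ^ 2 := by
  refine sq_mul_le_of_forall_lt pi_pos fun k k0 kπ => ?_
  have hl : ∀ x, HasDerivAt (fun y : ℝ => k * y) k x := fun x => by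
    simpa using (hasDerivAt_id x).const_mul k
  have := clamped_energy_le_of_wronskian (κ := k ^ 2) (k := 0) hf hf₁ hf₂ fl fr fl₁ fr₁
    (w₀ := fun x => 2 + 2 * cos (k * x) + (k * x) * sin (k * x))
    (w₁ := fun x => k * ((k * x) * cos (k * x) - sin (k * x)))
    (w₂ := fun x => -k ^ 2 * ((k * x) * sin (k * x)))
    (w₃ := fun x => -k ^ 3 * (sin (k * x) + (k * x) * cos (k * x)))
    (w₄ := fun x => -k ^ 4 * (2 * cos (k * x) - (k * x) * sin (k * x)))
    (fun x => ((((hl x).cos.const_mul 2).const_add 2).add ((hl x).mul (hl x).sin)).congr_deriv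
      (by ring))
    (fun x => ((((hl x).mul (hl x).cos).sub (hl x).sin).const_mul k).congr_deriv (by ring))
    (fun x => (((hl x).mul (hl x).sin).const_mul (-k ^ 2)).congr_deriv (by ring))
    (fun x => (((hl x).sin.add ((hl x).mul (hl x).cos)).const_mul (-k ^ 3)).congr_deriv (by ring))
    ?_ ?_
  · simpa using this
  · intro x hx
    have hlt : |k * x| < π := by
      rw [abs_mul, abs_of_pos k0]
      nlinarith [abs_le.2 hx]
    have h1 : -1 < cos (k * x) := by
      rw [← cos_abs, ← cos_pi]
      exact cos_lt_cos_of_nonneg_of_le_pi (abs_nonneg _) le_rfl hlt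
    have h2 : 0 ≤ (k * x) * sin (k * x) := by
      have : (k * x) * sin (k * x) = |k * x| * sin |k * x| := by
        rcases abs_choice (k * x) with h | h <;> simp [h]
      rw [this]
      exact mul_nonneg (abs_nonneg _) (sin_nonneg_of_nonneg_of_le_pi (abs_nonneg _) hlt.le)
    linarith
  · intro x
    have := sin_sq (k * x)
    linear_combination (-4 * k ^ 4) * this

theorem cos_mul_cosh_lt_one : cos (2 * 2.365) * cosh (2 * 2.365) < 1 := by
  have hp := pi_gt_d6
  have hp' := pi_lt_d6
  have hc : cos (2 * 2.365) ≤ 0.017612 := by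
    have : cos (2 * 2.365) = sin (2 * 2.365 - 3 * π / 2) := by
      rw [← cos_pi_div_two_sub, ← cos_neg, ← cos_add_two_pi]
      congr 1
      ring
    rw [this]
    have := sin_le (x := 2 * 2.365 - 3 * π / 2) (by linarith)
    linarith
  have he : exp (2 * 2.365) ≤ 113.4 := by
    have h5 : exp 5 ≤ 148.4132 := by
      have h := exp_one_lt_d9
      calc exp 5 = exp 1 ^ 5 := by rw [← exp_nat_mul]; norm_num
        _ ≤ 2.7182818286 ^ 5 := by gcongr
        _ ≤ _ := by norm_num
    have hx : 1.30973 ≤ exp 0.27 := by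
      have := sum_le_exp_of_nonneg (x := 0.27) (by norm_num) 4
      norm_num [Finset.sum_range_succ, Nat.factorial] at this ⊢
      linarith
    have hm : exp (2 * 2.365) * exp 0.27 = exp 5 := by
      rw [← exp_add]; norm_num
    nlinarith [exp_pos (2 * 2.365)]
  have hn : exp (-(2 * 2.365)) ≤ 0.01 := by
    rw [exp_neg]
    have : (100 : ℝ) ≤ exp (2 * 2.365) := by
      have h := exp_one_gt_d9
      have h4 : (2.718 : ℝ) ^ 4 ≤ exp 4 := by
        calc (2.718 : ℝ) ^ 4 ≤ exp 1 ^ 4 := by gcongr; linarith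
          _ = exp 4 := by rw [← exp_nat_mul]; norm_num
      have hx := quadratic_le_exp_of_nonneg (x := 0.73) (by norm_num)
      have hm : exp (2 * 2.365) = exp 4 * exp 0.73 := by
        rw [← exp_add]; norm_num
      rw [hm]
      norm_num at h4 hx ⊢
      nlinarith
    rw [inv_le_comm₀ (exp_pos _) (by norm_num)]
    norm_num at this ⊢
    linarith
  have hC : cosh (2 * 2.365) ≤ 56.71 := by
    rw [cosh_eq]; linarith
  nlinarith [cosh_pos (2 * 2.365 : ℝ)]

/-- The Wronskian of `cos + A cosh` and `A sin + sinh`. -/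
noncomputable def beamWronskian (A t : ℝ) : ℝ :=
  2 * A + (1 + A ^ 2) * (cos t * cosh t) + (1 - A ^ 2) * (sin t * sinh t)

theorem hasDerivAt_beamWronskian (A t : ℝ) :
    HasDerivAt (beamWronskian A) (2 * (cos t * sinh t) - 2 * A ^ 2 * (sin t * cosh t)) t := by
  refine (((((hasDerivAt_cos t).mul (hasDerivAt_cosh t)).const_mul (1 + A ^ 2)).const_add
    (2 * A)).add (((hasDerivAt_sin t).mul (hasDerivAt_sinh t)).const_mul
      (1 - A ^ 2))).congr_deriv ?_
  ring

theorem exists_beamWronskian_pos :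
    ∃ A : ℝ, ∀ t : ℝ, |t| ≤ 2.365 → 0 < beamWronskian A t := by
  have hp := pi_gt_d2
  have hp' := pi_lt_d2
  obtain ⟨A, A0, A1, hend⟩ : ∃ A : ℝ, 0 < A ∧ A ≤ 1 ∧ 0 < beamWronskian A 2.365 := by
    have hs : 0 ≤ sin 2.365 := sin_nonneg_of_nonneg_of_le_pi (by norm_num) (by linarith)
    have hc : cos 2.365 ≤ 0 :=
      cos_nonpos_of_pi_div_two_le_of_le (by linarith) (by linarith)
    have hC := one_le_cosh 2.365
    have hS : (1 : ℝ) ≤ sinh 2.365 :=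
      le_trans (by norm_num) (self_le_sinh_iff.2 (by norm_num : (0 : ℝ) ≤ 2.365))
    have hcs := sin_sq_add_cos_sq 2.365
    have hCS := cosh_sq_sub_sinh_sq 2.365
    have hlt := cos_mul_cosh_lt_one
    rw [cos_two_mul, cosh_two_mul] at hlt
    unfold beamWronskian
    generalize sin 2.365 = s at *
    generalize cos 2.365 = c at *
    generalize cosh 2.365 = C at *
    generalize sinh 2.365 = S at *
    have hsc : 1 ≤ s - c := by nlinarith
    have hP : 1 ≤ s * S - c * C := by nlinarith
    refine ⟨1 / (s * S - c * C), by positivity, (div_le_one (by linarith)).2 hP, ?_⟩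
    have hP0 : s * S - c * C ≠ 0 := by positivity
    have hval : 2 * (1 / (s * S - c * C)) + (1 + (1 / (s * S - c * C)) ^ 2) * (c * C)
        + (1 - (1 / (s * S - c * C)) ^ 2) * (s * S)
        = (1 - (c * C - s * S) * (c * C + s * S)) / (s * S - c * C) := by
      field_simp
      ring
    rw [hval]
    refine div_pos ?_ (by linarith)
    have e1 : s ^ 2 = 1 - c ^ 2 := by linarith
    have e2 : S ^ 2 = C ^ 2 - 1 := by linarith
    have e3 : (c * C - s * S) * (c * C + s * S) = c ^ 2 * C ^ 2 - s ^ 2 * S ^ 2 := by ring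
    rw [e3, e1, e2]
    rw [e2] at hlt
    nlinarith
  refine ⟨A, fun t ht => ?_⟩
  have hA2 : A ^ 2 ≤ 1 := by nlinarith
  have heven : beamWronskian A t = beamWronskian A |t| := by
    rcases abs_choice t with h | h <;> simp [h, beamWronskian]
  rw [heven]
  rcases le_total |t| (π / 2) with h | h
  · have hc : 0 ≤ cos |t| := cos_nonneg_of_mem_Icc ⟨by linarith [abs_nonneg t], h⟩
    have hs : 0 ≤ sin |t| := sin_nonneg_of_nonneg_of_le_pi (abs_nonneg _) (by linarith)
    have hS : 0 ≤ sinh |t| := sinh_nonneg_iff.2 (abs_nonneg _)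
    have hA3 : 0 ≤ 1 - A ^ 2 := by linarith
    have := cosh_pos |t|
    unfold beamWronskian
    positivity
  · have hanti : AntitoneOn (beamWronskian A) (Set.Icc (π / 2) 2.365) := by
      refine antitoneOn_of_deriv_nonpos (convex_Icc _ _)
        (fun x _ => (hasDerivAt_beamWronskian A x).continuousAt.continuousWithinAt)
        (fun x _ => (hasDerivAt_beamWronskian A x).differentiableAt.differentiableWithinAt) ?_
      intro x hx
      rw [interior_Icc] at hx
      rw [(hasDerivAt_beamWronskian A x).deriv]
      have hc : cos x ≤ 0 := cos_nonpos_of_pi_div_two_le_of_le hx.1.le (by linarith [hx.2])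
      have hs : 0 ≤ sin x :=
        sin_nonneg_of_nonneg_of_le_pi (by linarith [hx.1]) (by linarith [hx.2])
      have hS : 0 ≤ sinh x := sinh_nonneg_iff.2 (by linarith [hx.1])
      have h1 : cos x * sinh x ≤ 0 := mul_nonpos_of_nonpos_of_nonneg hc hS
      have h2 : 0 ≤ A ^ 2 * (sin x * cosh x) := by
        have := cosh_pos x
        positivity
      linarith
    exact hend.trans_le (hanti ⟨h, ht⟩ ⟨by linarith, le_rfl⟩ ht)

theorem clamped_poincare {f f₁ f₂ : ℝ → ℝ}
    (hf : ∀ x, HasDerivAt f (f₁ x) x) (hf₁ : ∀ x, HasDerivAt f₁ (f₂ x) x) (hf₂ : Continuous f₂)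
    (fl : f (-1) = 0) (fr : f 1 = 0) (fl₁ : f₁ (-1) = 0) (fr₁ : f₁ 1 = 0) :
    ((2.365 : ℝ) ^ 2) ^ 2 * (∫ x in (-1 : ℝ)..1, f x ^ 2) ≤ ∫ x in (-1 : ℝ)..1, f₂ x ^ 2 := by
  obtain ⟨A, hA⟩ := exists_beamWronskian_pos
  obtain ⟨k, hk⟩ : ∃ k : ℝ, k = 2.365 := ⟨_, rfl⟩
  rw [← hk] at hA ⊢
  have k0 : 0 < k := by rw [hk]; norm_num
  have hl : ∀ x, HasDerivAt (fun y : ℝ => k * y) k x := fun x => by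
    simpa using (hasDerivAt_id x).const_mul k
  have := clamped_energy_le_of_wronskian (κ := 0) (k := (k ^ 2) ^ 2) hf hf₁ hf₂ fl fr fl₁ fr₁
    (w₀ := fun x => beamWronskian A (k * x))
    (w₁ := fun x => 2 * k * (cos (k * x) * sinh (k * x) - A ^ 2 * (sin (k * x) * cosh (k * x))))
    (w₂ := fun x => 2 * k ^ 2 * (cos (k * x) * cosh (k * x) - sin (k * x) * sinh (k * x)
      - A ^ 2 * (cos (k * x) * cosh (k * x) + sin (k * x) * sinh (k * x))))
    (w₃ := fun x => -4 * k ^ 3 * (sin (k * x) * cosh (k * x)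
      + A ^ 2 * (cos (k * x) * sinh (k * x))))
    (w₄ := fun x => -4 * k ^ 4 * (cos (k * x) * cosh (k * x) + sin (k * x) * sinh (k * x)
      + A ^ 2 * (cos (k * x) * cosh (k * x) - sin (k * x) * sinh (k * x))))
    (fun x => ((hasDerivAt_beamWronskian A (k * x)).comp x (hl x)).congr_deriv (by ring))
    (fun x => ((((hl x).cos.mul (hl x).sinh).sub
      (((hl x).sin.mul (hl x).cosh).const_mul (A ^ 2))).const_mul (2 * k)).congr_deriv (by ring))
    (fun x => (((((hl x).cos.mul (hl x).cosh).sub ((hl x).sin.mul (hl x).sinh)).sub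
      ((((hl x).cos.mul (hl x).cosh).add ((hl x).sin.mul (hl x).sinh)).const_mul
        (A ^ 2))).const_mul (2 * k ^ 2)).congr_deriv (by ring))
    (fun x => ((((hl x).sin.mul (hl x).cosh).add
      (((hl x).cos.mul (hl x).sinh).const_mul (A ^ 2))).const_mul (-4 * k ^ 3)).congr_deriv
        (by ring))
    ?_ ?_
  · simpa using this
  · intro x hx
    refine hA _ ?_
    rw [abs_mul, abs_of_pos k0]
    nlinarith [abs_le.2 hx]
  · intro x
    have h1 := sin_sq (k * x)
    have h2 := sinh_sq (k * x)
    unfold beamWronskian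
    generalize sin (k * x) = s at *
    generalize cos (k * x) = c at *
    generalize cosh (k * x) = C at *
    generalize sinh (k * x) = S at *
    simp only [zero_mul, add_zero]
    ring_nf
    simp only [h1, h2]
    ring

theorem ContDiff.hasDerivAt_deriv_of_succ {E : Type*} [NormedAddCommGroup E] [NormedSpace ℝ E]
    {f : ℝ → E} {n : ℕ} (hf : ContDiff ℝ (n + 1) f) :
    (∀ x, HasDerivAt f (deriv f x) x) ∧ ContDiff ℝ n (deriv f) :=
  ⟨fun x => ((contDiff_succ_iff_deriv.1 hf).1 x).hasDerivAt, (contDiff_succ_iff_deriv.1 hf).2.2⟩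

theorem Complex.hasDerivAt_re_of_real {f : ℝ → ℂ} {f' : ℂ} {x : ℝ} (h : HasDerivAt f f' x) :
    HasDerivAt (fun y => (f y).re) f'.re x :=
  Complex.reCLM.hasFDerivAt.comp_hasDerivAt x h

theorem Complex.hasDerivAt_im_of_real {f : ℝ → ℂ} {f' : ℂ} {x : ℝ} (h : HasDerivAt f f' x) :
    HasDerivAt (fun y => (f y).im) f'.im x :=
  Complex.imCLM.hasFDerivAt.comp_hasDerivAt x h

/-- Energy inequality for the modified Orr–Sommerfeld equation, written with the real part `f`
and the imaginary part `g` of the solution. -/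
theorem orr_sommerfeld_energy_inequality
    {U U₁ U₂ m m₁ n n₁ n₂ f f₁ f₂ f₃ f₄ g g₁ g₂ g₃ g₄ : ℝ → ℝ} {α Re p q a b : ℝ}
    (hα : 0 < α) (hRe : 0 < Re)
    (hU : ∀ x, HasDerivAt U (U₁ x) x)
    (hm : ∀ x, HasDerivAt m (m₁ x) x)
    (hn : ∀ x, HasDerivAt n (n₁ x) x) (hn₁ : ∀ x, HasDerivAt n₁ (n₂ x) x)
    (hf : ∀ x, HasDerivAt f (f₁ x) x) (hf₁ : ∀ x, HasDerivAt f₁ (f₂ x) x)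
    (hf₂ : ∀ x, HasDerivAt f₂ (f₃ x) x) (hf₃ : ∀ x, HasDerivAt f₃ (f₄ x) x)
    (hg : ∀ x, HasDerivAt g (g₁ x) x) (hg₁ : ∀ x, HasDerivAt g₁ (g₂ x) x)
    (hg₂ : ∀ x, HasDerivAt g₂ (g₃ x) x) (hg₃ : ∀ x, HasDerivAt g₃ (g₄ x) x)
    (fl : f (-1) = 0) (fr : f 1 = 0) (fl₁ : f₁ (-1) = 0) (fr₁ : f₁ 1 = 0)
    (gl : g (-1) = 0) (gr : g 1 = 0) (gl₁ : g₁ (-1) = 0) (gr₁ : g₁ 1 = 0)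
    (hq : ∀ x ∈ Set.Icc (-1 : ℝ) 1, |U₁ x| ≤ q)
    (hpn : ∀ x ∈ Set.Icc (-1 : ℝ) 1, p ≤ n x)
    (hnm : ∀ x ∈ Set.Icc (-1 : ℝ) 1, n x ≤ m x)
    (hre : ∀ x ∈ Set.Icc (-1 : ℝ) 1,
      α * (a * (f₂ x - α ^ 2 * f x) - b * (g₂ x - α ^ 2 * g x))
        = α * (U x * (f₂ x - α ^ 2 * f x) - U₂ x * f x)
          + 4 * α ^ 2 / Re * (m₁ x * g₁ x + m x * g₂ x)
          - 1 / Re * (n₂ x * (g₂ x + α ^ 2 * g x) + 2 * n₁ x * (g₃ x + α ^ 2 * g₁ x)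
            + n x * (g₄ x + α ^ 2 * g₂ x) + α ^ 2 * n x * (g₂ x + α ^ 2 * g x)))
    (him : ∀ x ∈ Set.Icc (-1 : ℝ) 1,
      α * (a * (g₂ x - α ^ 2 * g x) + b * (f₂ x - α ^ 2 * f x))
        = α * (U x * (g₂ x - α ^ 2 * g x) - U₂ x * g x)
          - 4 * α ^ 2 / Re * (m₁ x * f₁ x + m x * f₂ x)
          + 1 / Re * (n₂ x * (f₂ x + α ^ 2 * f x) + 2 * n₁ x * (f₃ x + α ^ 2 * f₁ x)
            + n x * (f₄ x + α ^ 2 * f₂ x) + α ^ 2 * n x * (f₂ x + α ^ 2 * f x))) :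
    α * b * ((∫ x in (-1 : ℝ)..1, (f₁ x ^ 2 + g₁ x ^ 2))
        + α ^ 2 * ∫ x in (-1 : ℝ)..1, (f x ^ 2 + g x ^ 2))
      + p / Re * ((∫ x in (-1 : ℝ)..1, (f₂ x ^ 2 + g₂ x ^ 2))
        + 2 * α ^ 2 * (∫ x in (-1 : ℝ)..1, (f₁ x ^ 2 + g₁ x ^ 2))
        + α ^ 4 * ∫ x in (-1 : ℝ)..1, (f x ^ 2 + g x ^ 2))
      ≤ α * q * ∫ x in (-1 : ℝ)..1, |f x * g₁ x - g x * f₁ x| := by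
  have cont : ∀ {h h' : ℝ → ℝ}, (∀ x, HasDerivAt h (h' x) x) → Continuous h :=
    fun hh => continuous_iff_continuousAt.2 fun x => (hh x).continuousAt
  have cf := cont hf
  have cf₁ := cont hf₁
  have cf₂ := cont hf₂
  have cg := cont hg
  have cg₁ := cont hg₁
  have cg₂ := cont hg₂
  have key := integral_le_zero_of_le_deriv
    (F := fun x => α * (a - U x) * (f x * g₁ x - g x * f₁ x)
      + α * b * (f x * f₁ x + g x * g₁ x)
      + 4 * α ^ 2 / Re * (m x * (f x * f₁ x + g x * g₁ x))
      - 1 / Re * ((n₁ x * (f₂ x + α ^ 2 * f x) + n x * (f₃ x + α ^ 2 * f₁ x)) * f x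
        + (n₁ x * (g₂ x + α ^ 2 * g x) + n x * (g₃ x + α ^ 2 * g₁ x)) * g x)
      + 1 / Re * (n x * ((f₂ x + α ^ 2 * f x) * f₁ x + (g₂ x + α ^ 2 * g x) * g₁ x))
      - 2 * α ^ 2 * p / Re * (f x * f₁ x + g x * g₁ x))
    (F' := fun x => α * b * (f₁ x ^ 2 + g₁ x ^ 2 + α ^ 2 * (f x ^ 2 + g x ^ 2))
      - α * U₁ x * (f x * g₁ x - g x * f₁ x)
      + 4 * α ^ 2 / Re * m x * (f₁ x ^ 2 + g₁ x ^ 2)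
      + 1 / Re * n x * ((f₂ x + α ^ 2 * f x) ^ 2 + (g₂ x + α ^ 2 * g x) ^ 2)
      - 2 * α ^ 2 * p / Re * (f₁ x ^ 2 + g₁ x ^ 2 + f x * f₂ x + g x * g₂ x))
    (φ := fun x => α * b * ((f₁ x ^ 2 + g₁ x ^ 2) + α ^ 2 * (f x ^ 2 + g x ^ 2))
      + p / Re * ((f₂ x ^ 2 + g₂ x ^ 2) + 2 * α ^ 2 * (f₁ x ^ 2 + g₁ x ^ 2)
        + α ^ 4 * (f x ^ 2 + g x ^ 2))
      - α * q * |f x * g₁ x - g x * f₁ x|) ?_ (by fun_prop) ?_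
    (by simp [fr, fr₁, gr, gr₁]) (by simp [fl, fl₁, gl, gl₁])
  · have expand : ∀ e₀ e₁ e₂ j : ℝ → ℝ, Continuous e₀ → Continuous e₁ → Continuous e₂ →
        Continuous j → ∫ x in (-1 : ℝ)..1, (α * b * (e₁ x + α ^ 2 * e₀ x)
          + p / Re * (e₂ x + 2 * α ^ 2 * e₁ x + α ^ 4 * e₀ x) - α * q * j x)
        = α * b * ((∫ x in (-1 : ℝ)..1, e₁ x) + α ^ 2 * ∫ x in (-1 : ℝ)..1, e₀ x)
          + p / Re * ((∫ x in (-1 : ℝ)..1, e₂ x) + 2 * α ^ 2 * (∫ x in (-1 : ℝ)..1, e₁ x)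
            + α ^ 4 * ∫ x in (-1 : ℝ)..1, e₀ x) - α * q * ∫ x in (-1 : ℝ)..1, j x := by
      intro e₀ e₁ e₂ j c₀ c₁ c₂ cj
      simp only [← intervalIntegral.integral_const_mul]
      rw [← intervalIntegral.integral_add, ← intervalIntegral.integral_add,
        ← intervalIntegral.integral_add, ← intervalIntegral.integral_const_mul,
        ← intervalIntegral.integral_const_mul, ← intervalIntegral.integral_add,
        ← intervalIntegral.integral_sub]
      all_goals exact Continuous.intervalIntegrable (by fun_prop) _ _
    rw [expand (fun x => f x ^ 2 + g x ^ 2) (fun x => f₁ x ^ 2 + g₁ x ^ 2)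
      (fun x => f₂ x ^ 2 + g₂ x ^ 2) (fun x => |f x * g₁ x - g x * f₁ x|)
      (by fun_prop) (by fun_prop) (by fun_prop) (by fun_prop)] at key
    linarith
  · intro x hx
    have hfg := ((hf x).mul (hf₁ x)).add ((hg x).mul (hg₁ x))
    have hF := ((hf₂ x).add ((hf x).const_mul (α ^ 2)))
    have hG := ((hg₂ x).add ((hg x).const_mul (α ^ 2)))
    have hF₁ := ((hf₃ x).add ((hf₁ x).const_mul (α ^ 2)))
    have hG₁ := ((hg₃ x).add ((hg₁ x).const_mul (α ^ 2)))
    have := (((((((hU x).const_sub a).const_mul α).mul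
      (((hf x).mul (hg₁ x)).sub ((hg x).mul (hf₁ x)))).add (hfg.const_mul (α * b))).add
      (((hm x).mul hfg).const_mul (4 * α ^ 2 / Re))).sub
      ((((((hn₁ x).mul hF).add ((hn x).mul hF₁)).mul (hf x)).add
        ((((hn₁ x).mul hG).add ((hn x).mul hG₁)).mul (hg x))).const_mul (1 / Re))).add
      (((hn x).mul ((hF.mul (hf₁ x)).add (hG.mul (hg₁ x)))).const_mul (1 / Re)) |>.sub
      (hfg.const_mul (2 * α ^ 2 * p / Re))
    refine this.congr_deriv ?_
    simp only [Pi.add_apply, Pi.mul_apply, Pi.sub_apply]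
    linear_combination f x * him x hx - g x * hre x hx
  · intro x hx
    have h1 : U₁ x * (f x * g₁ x - g x * f₁ x) ≤ q * |f x * g₁ x - g x * f₁ x| := by
      refine (le_abs_self _).trans ?_
      rw [abs_mul]
      exact mul_le_mul_of_nonneg_right (hq x hx) (abs_nonneg _)
    have h2 : p * (f₁ x ^ 2 + g₁ x ^ 2) ≤ m x * (f₁ x ^ 2 + g₁ x ^ 2) :=
      mul_le_mul_of_nonneg_right ((hpn x hx).trans (hnm x hx)) (by positivity)
    have h3 : p * ((f₂ x + α ^ 2 * f x) ^ 2 + (g₂ x + α ^ 2 * g x) ^ 2)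
        ≤ n x * ((f₂ x + α ^ 2 * f x) ^ 2 + (g₂ x + α ^ 2 * g x) ^ 2) :=
      mul_le_mul_of_nonneg_right (hpn x hx) (by positivity)
    have h1' := mul_le_mul_of_nonneg_left h1 hα.le
    have h2' := mul_le_mul_of_nonneg_left h2 (show 0 ≤ 4 * α ^ 2 / Re by positivity)
    have h3' := mul_le_mul_of_nonneg_left h3 (show 0 ≤ 1 / Re by positivity)
    linear_combination h1' + h2' + h3'

theorem integral_abs_wronskian_le {f f₁ g g₁ : ℝ → ℝ} (hf : Continuous f) (hf₁ : Continuous f₁)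
    (hg : Continuous g) (hg₁ : Continuous g₁) (l r : ℝ) :
    2 * (l * r) * ∫ x in (-1 : ℝ)..1, |f x * g₁ x - g x * f₁ x|
      ≤ l ^ 2 * (∫ x in (-1 : ℝ)..1, (f x ^ 2 + g x ^ 2))
        + r ^ 2 * ∫ x in (-1 : ℝ)..1, (f₁ x ^ 2 + g₁ x ^ 2) := by
  rw [← intervalIntegral.integral_const_mul, ← intervalIntegral.integral_const_mul,
    ← intervalIntegral.integral_const_mul, ← intervalIntegral.integral_add]
  · refine intervalIntegral.integral_mono_on (by norm_num)
      (Continuous.intervalIntegrable (by fun_prop) _ _)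
      (Continuous.intervalIntegrable (by fun_prop) _ _) fun x _ => ?_
    rcases abs_choice (f x * g₁ x - g x * f₁ x) with h | h <;> rw [h]
    · linarith [sq_nonneg (l * f x - r * g₁ x), sq_nonneg (l * g x + r * f₁ x)]
    · linarith [sq_nonneg (l * f x + r * g₁ x), sq_nonneg (l * g x - r * f₁ x)]
  all_goals exact Continuous.intervalIntegrable (by fun_prop) _ _

/-- **No amplified disturbances.**
With `λ₃ = (2.365)²`, if `q α Re < p · max(λ₃ π + 2^{3/2} α³, λ₃ π + π α²)`, then
there is no solution `v` of the modified Orr–Sommerfeld equation, not identically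
zero on `[-1,1]`, whose wave speed `c` satisfies `Im c > 0`. -/
theorem orr_sommerfeld_no_amplified_disturbances
    (U μ μt : ℝ → ℝ) (α Re p q : ℝ)
    (hU : ContDiff ℝ 2 U) (hμ : ContDiff ℝ 1 μ) (hμt : ContDiff ℝ 2 μt)
    (hα : 0 < α) (hRe : 0 < Re)
    (hq : IsGreatest ((fun y => |deriv U y|) '' Set.Icc (-1 : ℝ) 1) q)
    (hp : IsLeast (μt '' Set.Icc (-1 : ℝ) 1) p) (hppos : 0 < p)
    (hμtμ : ∀ y ∈ Set.Icc (-1 : ℝ) 1, μt y ≤ μ y)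
    (hsmall : q * α * Re
      < p * max ((2.365 : ℝ) ^ 2 * π + 2 ^ ((3 : ℝ) / 2) * α ^ 3)
                ((2.365 : ℝ) ^ 2 * π + π * α ^ 2)) :
    ¬ ∃ (v : ℝ → ℂ) (c : ℂ),
        ContDiff ℝ 4 v ∧
        v (-1) = 0 ∧ v 1 = 0 ∧ deriv v (-1) = 0 ∧ deriv v 1 = 0 ∧
        (∃ y ∈ Set.Icc (-1 : ℝ) 1, v y ≠ 0) ∧
        (∀ y ∈ Set.Icc (-1 : ℝ) 1,
          (α : ℂ) * c * (deriv (deriv v) y - (α : ℂ) ^ 2 * v y)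
            = (α : ℂ) * ((U y : ℂ) * (deriv (deriv v) y - (α : ℂ) ^ 2 * v y)
                - ((deriv (deriv U) y : ℝ) : ℂ) * v y)
              - (4 * Complex.I * (α : ℂ) ^ 2 / (Re : ℂ)) *
                  deriv (fun z => ((μ z : ℝ) : ℂ) * deriv v z) y
              + (Complex.I / (Re : ℂ)) *
                  (deriv (deriv (fun z => ((μt z : ℝ) : ℂ) *
                      (deriv (deriv v) z + (α : ℂ) ^ 2 * v z))) y
                    + (α : ℂ) ^ 2 * ((μt y : ℝ) : ℂ) *
                        (deriv (deriv v) y + (α : ℂ) ^ 2 * v y))) ∧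
        0 < c.im := by
  rintro ⟨v, c, hv, vl, vr, vl₁, vr₁, ⟨y₀, hy₀, hvy₀⟩, hode, hc⟩
  obtain ⟨hU₀, -⟩ := ContDiff.hasDerivAt_deriv_of_succ (n := 1) hU
  obtain ⟨hm₀, -⟩ := ContDiff.hasDerivAt_deriv_of_succ (n := 0) (by simpa using hμ)
  obtain ⟨hn₀, hμt₁⟩ := ContDiff.hasDerivAt_deriv_of_succ (n := 1) hμt
  obtain ⟨hn₁, -⟩ := ContDiff.hasDerivAt_deriv_of_succ (n := 0) (by simpa using hμt₁)
  obtain ⟨hv₀, cd₁⟩ := ContDiff.hasDerivAt_deriv_of_succ (n := 3) hv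
  obtain ⟨hv₁, cd₂⟩ := ContDiff.hasDerivAt_deriv_of_succ (n := 2) cd₁
  obtain ⟨hv₂, cd₃⟩ := ContDiff.hasDerivAt_deriv_of_succ (n := 1) cd₂
  obtain ⟨hv₃, -⟩ := ContDiff.hasDerivAt_deriv_of_succ (n := 0) (by simpa using cd₃)
  set v₁ := deriv v
  set v₂ := deriv v₁
  set v₃ := deriv v₂
  set v₄ := deriv v₃
  have dm : ∀ y, deriv (fun z => ((μ z : ℝ) : ℂ) * v₁ z) y
      = (deriv μ y : ℝ) * v₁ y + (μ y : ℝ) * v₂ y := fun y =>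
    ((hm₀ y).ofReal_comp.mul (hv₁ y)).deriv
  have dn : ∀ y, HasDerivAt (fun z => ((μt z : ℝ) : ℂ) * (v₂ z + (α : ℂ) ^ 2 * v z))
      ((deriv μt y : ℝ) * (v₂ y + (α : ℂ) ^ 2 * v y)
        + (μt y : ℝ) * (v₃ y + (α : ℂ) ^ 2 * v₁ y)) y := fun y =>
    (hn₀ y).ofReal_comp.mul ((hv₂ y).add ((hv₀ y).const_mul _))
  have dn₂ : ∀ y, deriv (deriv (fun z => ((μt z : ℝ) : ℂ) * (v₂ z + (α : ℂ) ^ 2 * v z))) y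
      = (deriv (deriv μt) y : ℝ) * (v₂ y + (α : ℂ) ^ 2 * v y)
        + 2 * (deriv μt y : ℝ) * (v₃ y + (α : ℂ) ^ 2 * v₁ y)
        + (μt y : ℝ) * (v₄ y + (α : ℂ) ^ 2 * v₂ y) := fun y => by
    rw [funext fun y => (dn y).deriv]
    have h := ((hn₁ y).ofReal_comp.mul ((hv₂ y).add ((hv₀ y).const_mul ((α : ℂ) ^ 2)))).add
      ((hn₀ y).ofReal_comp.mul ((hv₃ y).add ((hv₁ y).const_mul ((α : ℂ) ^ 2))))
    refine h.deriv.trans ?_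
    simp only [Pi.add_apply]
    ring
  have re₀ := fun x => Complex.hasDerivAt_re_of_real (hv₀ x)
  have re₁ := fun x => Complex.hasDerivAt_re_of_real (hv₁ x)
  have re₂ := fun x => Complex.hasDerivAt_re_of_real (hv₂ x)
  have re₃ := fun x => Complex.hasDerivAt_re_of_real (hv₃ x)
  have im₀ := fun x => Complex.hasDerivAt_im_of_real (hv₀ x)
  have im₁ := fun x => Complex.hasDerivAt_im_of_real (hv₁ x)
  have im₂ := fun x => Complex.hasDerivAt_im_of_real (hv₂ x)
  have im₃ := fun x => Complex.hasDerivAt_im_of_real (hv₃ x)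
  have hode' : ∀ y ∈ Set.Icc (-1 : ℝ) 1,
      (α : ℂ) * (c * (v₂ y - ((α ^ 2 : ℝ) : ℂ) * v y))
        = (α : ℂ) * ((U y : ℂ) * (v₂ y - ((α ^ 2 : ℝ) : ℂ) * v y)
            - ((deriv (deriv U) y : ℝ) : ℂ) * v y)
          - Complex.I * (((4 * α ^ 2 / Re : ℝ) : ℂ) *
              ((deriv μ y : ℝ) * v₁ y + (μ y : ℝ) * v₂ y))
          + Complex.I * (((1 / Re : ℝ) : ℂ) *
              ((deriv (deriv μt) y : ℝ) * (v₂ y + ((α ^ 2 : ℝ) : ℂ) * v y)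
                + ((2 * deriv μt y : ℝ) : ℂ) * (v₃ y + ((α ^ 2 : ℝ) : ℂ) * v₁ y)
                + (μt y : ℝ) * (v₄ y + ((α ^ 2 : ℝ) : ℂ) * v₂ y)
                + ((α ^ 2 * μt y : ℝ) : ℂ) * (v₂ y + ((α ^ 2 : ℝ) : ℂ) * v y))) := by
    intro y hy
    have h := hode y hy
    rw [dm, dn₂] at h
    push_cast
    linear_combination h
  have energy := orr_sommerfeld_energy_inequality (U₂ := deriv (deriv U)) (p := p) (q := q)
    (a := c.re) (b := c.im) hα hRe hU₀ hm₀ hn₀ hn₁ re₀ re₁ re₂ re₃ im₀ im₁ im₂ im₃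
    (by simp [vl]) (by simp [vr]) (by simp [vl₁]) (by simp [vr₁])
    (by simp [vl]) (by simp [vr]) (by simp [vl₁]) (by simp [vr₁])
    (fun x hx => hq.2 ⟨x, hx, rfl⟩) (fun x hx => hp.2 ⟨x, hx, rfl⟩) hμtμ
    (fun y hy => by
      have h := congrArg Complex.re (hode' y hy)
      simp only [Complex.add_re, Complex.sub_re, Complex.mul_re, Complex.add_im, Complex.sub_im,
        Complex.mul_im, Complex.ofReal_re, Complex.ofReal_im, Complex.I_re, Complex.I_im] at h
      linear_combination h)
    (fun y hy => by
      have h := congrArg Complex.im (hode' y hy)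
      simp only [Complex.add_re, Complex.sub_re, Complex.mul_re, Complex.add_im, Complex.sub_im,
        Complex.mul_im, Complex.ofReal_re, Complex.ofReal_im, Complex.I_re, Complex.I_im] at h
      linear_combination h)
  have cv : Continuous v := hv.continuous
  have cv₁ : Continuous v₁ := cd₁.continuous
  have cv₂ : Continuous v₂ := cd₂.continuous
  have hAf := dirichlet_poincare re₀ (by fun_prop) (by simp [vl]) (by simp [vr])
  have hAg := dirichlet_poincare im₀ (by fun_prop) (by simp [vl]) (by simp [vr])
  have hBf := clamped_poincare_deriv re₀ re₁ (by fun_prop) (by simp [vl]) (by simp [vr])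
    (by simp [vl₁]) (by simp [vr₁])
  have hBg := clamped_poincare_deriv im₀ im₁ (by fun_prop) (by simp [vl]) (by simp [vr])
    (by simp [vl₁]) (by simp [vr₁])
  have hCf := clamped_poincare re₀ re₁ (by fun_prop) (by simp [vl]) (by simp [vr])
    (by simp [vl₁]) (by simp [vr₁])
  have hCg := clamped_poincare im₀ im₁ (by fun_prop) (by simp [vl]) (by simp [vr])
    (by simp [vl₁]) (by simp [vr₁])
  have hJ := integral_abs_wronskian_le (f := fun x => (v x).re) (f₁ := fun x => (v₁ x).re)
    (g := fun x => (v x).im) (g₁ := fun x => (v₁ x).im)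
    (by fun_prop) (by fun_prop) (by fun_prop) (by fun_prop)
  have split : ∀ w : ℝ → ℂ, Continuous w → ∫ x in (-1 : ℝ)..1, ((w x).re ^ 2 + (w x).im ^ 2)
      = (∫ x in (-1 : ℝ)..1, (w x).re ^ 2) + ∫ x in (-1 : ℝ)..1, (w x).im ^ 2 := fun w hw =>
    intervalIntegral.integral_add (Continuous.intervalIntegrable (by fun_prop) _ _)
      (Continuous.intervalIntegrable (by fun_prop) _ _)
  have hA : (π / 2) ^ 2 * (∫ x in (-1 : ℝ)..1, ((v x).re ^ 2 + (v x).im ^ 2))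
      ≤ ∫ x in (-1 : ℝ)..1, ((v₁ x).re ^ 2 + (v₁ x).im ^ 2) := by
    rw [split v cv, split v₁ cv₁]; linarith
  have hB : π ^ 2 * (∫ x in (-1 : ℝ)..1, ((v₁ x).re ^ 2 + (v₁ x).im ^ 2))
      ≤ ∫ x in (-1 : ℝ)..1, ((v₂ x).re ^ 2 + (v₂ x).im ^ 2) := by
    rw [split v₁ cv₁, split v₂ cv₂]; linarith
  have hC : ((2.365 : ℝ) ^ 2) ^ 2 * (∫ x in (-1 : ℝ)..1, ((v x).re ^ 2 + (v x).im ^ 2))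
      ≤ ∫ x in (-1 : ℝ)..1, ((v₂ x).re ^ 2 + (v₂ x).im ^ 2) := by
    rw [split v cv, split v₂ cv₂]; linarith
  have hN0 : 0 < ∫ x in (-1 : ℝ)..1, ((v x).re ^ 2 + (v x).im ^ 2) := by
    refine intervalIntegral.integral_pos (by norm_num)
      (Continuous.continuousOn (by fun_prop)) (fun x _ => by positivity) ⟨y₀, hy₀, ?_⟩
    have h := Complex.normSq_pos.2 hvy₀
    rw [Complex.normSq_apply] at h
    linarith
  have hN1 : 0 ≤ ∫ x in (-1 : ℝ)..1, ((v₁ x).re ^ 2 + (v₁ x).im ^ 2) :=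
    intervalIntegral.integral_nonneg (by norm_num) fun x _ => by positivity
  have hJ0 : 0 ≤ ∫ x in (-1 : ℝ)..1, |(v x).re * (v₁ x).im - (v x).im * (v₁ x).re| :=
    intervalIntegral.integral_nonneg (by norm_num) fun x _ => abs_nonneg _
  clear hAf hAg hBf hBg hCf hCg split
  generalize (∫ x in (-1 : ℝ)..1, ((v x).re ^ 2 + (v x).im ^ 2)) = N₀ at *
  generalize (∫ x in (-1 : ℝ)..1, ((v₁ x).re ^ 2 + (v₁ x).im ^ 2)) = N₁ at *
  generalize (∫ x in (-1 : ℝ)..1, ((v₂ x).re ^ 2 + (v₂ x).im ^ 2)) = N₂ at *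
  generalize (∫ x in (-1 : ℝ)..1, |(v x).re * (v₁ x).im - (v x).im * (v₁ x).re|) = J at *
  have hbend : (2.365 : ℝ) ^ 2 * π * J ≤ N₂ := by
    linarith [hJ ((2.365 : ℝ) ^ 2) π]
  have hsqrt : (2 : ℝ) ^ ((3 : ℝ) / 2) = 2 * √2 := by
    rw [show (3 : ℝ) / 2 = 1 + 1 / 2 by norm_num, rpow_add (by norm_num), rpow_one,
      sqrt_eq_rpow]
  have hmax : max ((2.365 : ℝ) ^ 2 * π + 2 ^ ((3 : ℝ) / 2) * α ^ 3)
      ((2.365 : ℝ) ^ 2 * π + π * α ^ 2) * J ≤ N₂ + 2 * α ^ 2 * N₁ + α ^ 4 * N₀ := by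
    rw [max_mul_of_nonneg _ _ hJ0, hsqrt]
    refine max_le ?_ ?_
    · have h := hJ (α ^ 2) (√2 * α)
      have h2 : (√2 * α) ^ 2 = 2 * α ^ 2 := by
        rw [mul_pow, sq_sqrt (by norm_num)]
      rw [h2] at h
      linarith
    · have h := mul_le_mul_of_nonneg_left (hJ (π / 2) 1) (sq_nonneg α)
      have h' := mul_le_mul_of_nonneg_left hA (sq_nonneg α)
      have h4 : 0 ≤ α ^ 4 * N₀ := by positivity
      linarith
  have hpos : 0 < α * c.im * (N₁ + α ^ 2 * N₀) := by positivity
  have h1 := mul_le_mul_of_nonneg_left hmax (show 0 ≤ p / Re by positivity)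
  have h2 := mul_le_mul_of_nonneg_right hsmall.le (show 0 ≤ J / Re by positivity)
  have h3 : q * α * Re * (J / Re) = α * q * J := by field_simp
  have h4 : ∀ M : ℝ, p * M * (J / Re) = p / Re * (M * J) := fun M => by ring
  rw [h3, h4] at h2
  linarith
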